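/- Let B(V^ℂ) be the bounded operators on a complex Banach space. If L is a Hermitian operator (its numerical range V(L) = {φ(L) : φ ∈ B(V^ℂ)*, ‖φ‖ = φ(Id) = 1} is real) and D is an operator with iD Hermitian, then ‖L + D‖ ≥ ‖D‖. -/

import Mathlib

open Filter Topology ComplexConjugate in
/-- If `F` is entire with `‖F w‖ ≤ exp |re w|` and `1 < ‖c‖`, then `F w + c * exp w` is at least as
large at a point of the right half-plane as at its mirror image in the imaginary axis. -/
theorem norm_add_mul_exp_neg_conj_le {F : ℂ → ℂ} (hF : Differentiable ℂ F)
    (hb : ∀ w, ‖F w‖ ≤ Real.exp |w.re|) {c : ℂ} (hc : 1 < ‖c‖) {w : ℂ} (hw : 0 ≤ w.re) :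
    ‖F (-conj w) + c * Complex.exp (-conj w)‖ ≤ ‖F w + c * Complex.exp w‖ := by
  set K : ℂ → ℂ := fun u => F (-u) + c * Complex.exp (-u) with hK
  set h : ℂ → ℂ := fun u => F u + c * Complex.exp u with hh
  have hKd : Differentiable ℂ K := by fun_prop
  have hhd : Differentiable ℂ h := by fun_prop
  have hlow : ∀ u : ℂ, 0 ≤ u.re → (‖c‖ - 1) * Real.exp u.re ≤ ‖h u‖ := by
    intro u hu
    have h1 := hb u
    rw [abs_of_nonneg hu] at h1
    have h2 := norm_sub_norm_le (c * Complex.exp u) (-F u)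
    rw [norm_neg, norm_mul, Complex.norm_exp, sub_neg_eq_add, add_comm (c * _)] at h2
    simp only [hh]
    linarith
  have hpos : ∀ u : ℂ, 0 ≤ u.re → 0 < ‖h u‖ := fun u hu =>
    lt_of_lt_of_le (mul_pos (by linarith) (Real.exp_pos _)) (hlow u hu)
  have hup : ∀ u : ℂ, 0 ≤ u.re → ‖K (conj u)‖ ≤ (‖c‖ + 1) * Real.exp u.re := by
    intro u hu
    have h1 := hb (-conj u)
    have h2 := norm_add_le (F (-conj u)) (c * Complex.exp (-conj u))
    simp only [Complex.neg_re, Complex.conj_re, abs_neg, abs_of_nonneg hu] at h1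
    rw [norm_mul, Complex.norm_exp, Complex.neg_re, Complex.conj_re] at h2
    have h3 : Real.exp (-u.re) ≤ Real.exp u.re := Real.exp_le_exp.2 (by linarith)
    have h4 := mul_le_mul_of_nonneg_left h3 (norm_nonneg c)
    simp only [hK]
    linarith
  set g : ℂ → ℂ := fun u => conj (K (conj u)) / h u with hg
  have hgn : ∀ u, ‖g u‖ = ‖K (conj u)‖ / ‖h u‖ := fun u => by simp [hg]
  have hgb : ∀ u : ℂ, 0 ≤ u.re → ‖g u‖ ≤ (‖c‖ + 1) / (‖c‖ - 1) := by
    intro u hu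
    rw [hgn]
    have := Real.exp_pos u.re
    calc ‖K (conj u)‖ / ‖h u‖ ≤ ((‖c‖ + 1) * Real.exp u.re) / ((‖c‖ - 1) * Real.exp u.re) :=
          div_le_div₀ (by positivity) (hup u hu) (mul_pos (by linarith) this) (hlow u hu)
      _ = _ := mul_div_mul_right _ _ this.ne'
  have key : ‖g w‖ ≤ 1 := by
    refine PhragmenLindelof.right_half_plane_of_bounded_on_real ?_ ⟨1, by norm_num, 0, ?_⟩ ?_ ?_ hw
    · refine DifferentiableOn.diffContOnCl fun u hu => ?_
      have hu' : 0 ≤ u.re := by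
        rw [Complex.closure_setOfPred_lt_re] at hu
        exact hu
      refine (DifferentiableAt.div ?_ (hhd u) (norm_pos_iff.1 (hpos u hu'))).differentiableWithinAt
      have := (hKd (conj u)).hasDerivAt.conj_conj
      rw [Complex.conj_conj] at this
      exact this.differentiableAt
    · refine Asymptotics.IsBigO.of_bound ((‖c‖ + 1) / (‖c‖ - 1)) ?_
      filter_upwards [mem_inf_of_right (mem_principal_self _)] with u hu
      simpa using hgb u (le_of_lt hu)
    · refine isBoundedUnder_of_eventually_le (a := (‖c‖ + 1) / (‖c‖ - 1)) ?_
      filter_upwards [eventually_ge_atTop 0] with x hx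
      exact hgb x (by simpa using hx)
    · intro x
      rw [hgn, div_le_one (hpos _ (by simp))]
      simp [hK, hh]
  rw [hgn, div_le_one (hpos w hw)] at key
  exact key

open Filter Topology in
/-- A real function with `f 0 = 0` that is nonnegative to the right of `0` has nonnegative
derivative at `0`. -/
theorem HasDerivAt.nonneg_of_nonneg_right {f : ℝ → ℝ} {f' : ℝ} (hf : HasDerivAt f f' 0)
    (h0 : f 0 = 0) (hpos : ∀ t, 0 ≤ t → 0 ≤ f t) : 0 ≤ f' := by
  have h := hf.hasDerivWithinAt (s := Set.Ioi 0)
  rw [hasDerivWithinAt_iff_tendsto_slope' (by simp)] at h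
  refine ge_of_tendsto h ?_
  filter_upwards [self_mem_nhdsWithin] with t ht
  rw [slope_def_field, h0, sub_zero, sub_zero]
  exact div_nonneg (hpos t (le_of_lt ht)) (le_of_lt ht)

open ComplexConjugate in
theorem re_deriv_add_mul_conj_add_nonneg {F : ℂ → ℂ} (hF : Differentiable ℂ F)
    (hb : ∀ w, ‖F w‖ ≤ Real.exp |w.re|) {c : ℂ} (hc : 1 < ‖c‖) :
    0 ≤ ((deriv F 0 + c) * conj (F 0 + c)).re := by
  set h : ℝ → ℂ := fun t => F t + c * Complex.exp t with hh
  have hd : HasDerivAt h (deriv F 0 + c) 0 := by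
    have h1 : HasDerivAt (fun u : ℂ => F u + c * Complex.exp u)
        (deriv F 0 + c * Complex.exp 0) ((0 : ℝ) : ℂ) := by
      rw [Complex.ofReal_zero]
      exact (hF 0).hasDerivAt.add ((Complex.hasDerivAt_exp 0).const_mul c)
    simpa using h1.comp_ofReal
  have hdn : HasDerivAt (fun t => h (-t)) (-(deriv F 0 + c)) 0 := by
    have := HasDerivAt.scomp (0 : ℝ) (h := fun t : ℝ => -t) (g₁ := h) (by simpa using hd)
      (hasDerivAt_neg 0)
    simpa only [neg_smul, one_smul] using! this
  have h0 : h 0 = F 0 + c := by simp [hh]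
  have hu := hd.norm_sq.sub hdn.norm_sq
  have := hu.nonneg_of_nonneg_right (by simp) fun t ht => by
    have := norm_add_mul_exp_neg_conj_le hF hb hc (w := t) (by simpa using ht)
    rw [Complex.conj_ofReal, ← Complex.ofReal_neg] at this
    simp only [Pi.sub_apply, sub_nonneg]
    gcongr
  simp only [neg_zero, h0, inner_neg_right, Complex.inner] at this
  linarith

open Filter Topology ComplexConjugate in
theorem norm_deriv_add_le {F : ℂ → ℂ} (hF : Differentiable ℂ F)
    (hb : ∀ w, ‖F w‖ ≤ Real.exp |w.re|) :
    ‖deriv F 0 + F 0‖ ≤ 1 + (deriv F 0 * conj (F 0)).re := by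
  set s := deriv F 0 + F 0 with hs
  obtain ⟨μ, hμ, hμs⟩ : ∃ μ : ℂ, ‖μ‖ = 1 ∧ (conj μ * s).re = -‖s‖ := by
    by_cases h : s = 0
    · exact ⟨1, by simp, by simp [h]⟩
    · have h' : (‖s‖ : ℂ) ≠ 0 := by simpa using h
      refine ⟨-s / ‖s‖, by simp [h], ?_⟩
      have : conj (-s / ‖s‖) * s = ((-‖s‖ : ℝ) : ℂ) := by
        rw [map_div₀, map_neg, Complex.conj_ofReal, div_mul_eq_mul_div, neg_mul,
          Complex.conj_mul', Complex.ofReal_neg]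
        field_simp
      rw [this, Complex.ofReal_re]
  have key : ∀ r : ℝ, 1 < r → 0 ≤ r ^ 2 + (deriv F 0 * conj (F 0)).re - r * ‖s‖ := by
    intro r hr
    have h1 := re_deriv_add_mul_conj_add_nonneg hF hb (c := r * μ)
      (by simpa [hμ, abs_of_pos (zero_lt_one.trans hr)] using hr)
    have h2 : (μ.re ^ 2 + μ.im ^ 2) = 1 := by
      have := Complex.sq_norm μ
      rw [hμ, Complex.normSq_apply] at this
      linarith
    simp only [hs, Complex.mul_re, Complex.mul_im, Complex.add_re, Complex.add_im,
      Complex.conj_re, Complex.conj_im, Complex.ofReal_re, Complex.ofReal_im] at h1 hμs ⊢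
    have h3 : r ^ 2 * (μ.re ^ 2 + μ.im ^ 2) = r ^ 2 := by rw [h2, mul_one]
    have h4 := congrArg (r * ·) hμs
    ring_nf at h1 h3 h4 ⊢
    linarith
  have ht : Tendsto (fun r : ℝ => r ^ 2 + (deriv F 0 * conj (F 0)).re - r * ‖s‖) (𝓝[>] 1)
      (𝓝 (1 ^ 2 + (deriv F 0 * conj (F 0)).re - 1 * ‖s‖)) := by
    refine Tendsto.mono_left (Continuous.tendsto ?_ 1) nhdsWithin_le_nhds
    fun_prop
  have := ge_of_tendsto ht (by filter_upwards [self_mem_nhdsWithin] with r hr using key r hr)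
  linarith

/-- Bernstein's inequality at the origin, for entire functions `F` with `‖F w‖ ≤ exp |re w|`. -/
theorem norm_deriv_zero_le_one_of_norm_le_exp_abs_re {F : ℂ → ℂ} (hF : Differentiable ℂ F)
    (hb : ∀ w, ‖F w‖ ≤ Real.exp |w.re|) : ‖deriv F 0‖ ≤ 1 := by
  have h1 := norm_deriv_add_le hF hb
  have h2 := norm_deriv_add_le (F := fun w => F (-w)) (by fun_prop)
    fun w => by simpa using hb (-w)
  rw [deriv_comp_neg] at h2
  simp only [neg_zero, neg_mul, Complex.neg_re] at h2
  have h3 := norm_sub_le (deriv F 0 + F 0) (-deriv F 0 + F 0)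
  have h4 : deriv F 0 + F 0 - (-deriv F 0 + F 0) = 2 * deriv F 0 := by ring
  rw [h4, norm_mul, Complex.norm_ofNat] at h3
  linarith

open Filter Topology NormedSpace in
/-- If `a - m` is dissipative, then `‖exp a‖ ≤ exp m`. -/
theorem ContinuousLinearMap.norm_exp_le_of_dissipative {Y : Type*} [NormedAddCommGroup Y]
    [NormedSpace ℂ Y] [CompleteSpace Y] (a : Y →L[ℂ] Y) (m : ℝ)
    (h : ∀ t : ℝ, 0 < t → ∀ y, (1 - t * m) * ‖y‖ ≤ ‖y - t • a y‖) :
    ‖exp a‖ ≤ Real.exp m := by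
  let : NormedAlgebra ℚ (Y →L[ℂ] Y) := .restrictScalars ℚ ℝ _
  set r : ℝ → (Y →L[ℂ] Y) := fun t => exp (t • (-a)) - 1 + t • a with hr
  have hr0 : r 0 = 0 := by simp [hr]
  have hrd : HasDerivAt r 0 0 := by
    have h1 := ((hasDerivAt_exp_smul_const (𝕂 := ℝ) (-a) 0).sub_const 1).add
      ((hasDerivAt_id (0 : ℝ)).smul_const a)
    refine h1.congr_deriv ?_ |>.congr_of_eventuallyEq (.of_forall fun t => ?_)
    · simp
    · simp [hr]
  -- the remainder at `1 / n` is `o(1 / n)`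
  have hlim : Tendsto (fun n : ℕ => (n : ℝ) * ‖r (1 / n)‖) atTop (𝓝 0) := by
    have h1 := hrd.isLittleO
    simp only [hr0, sub_zero, smul_zero] at h1
    have h2 := (h1.comp_tendsto tendsto_one_div_atTop_nhds_zero_nat).norm_left.tendsto_div_nhds_zero
    refine h2.congr fun n => ?_
    simp [div_eq_mul_inv, mul_comm]
  have hstep : ∀ n : ℕ, 0 < n → ∀ y,
      (1 + (-(m / n) - ‖r (1 / n)‖)) * ‖y‖ ≤ ‖exp ((1 / n : ℝ) • (-a)) y‖ := by
    intro n hn y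
    have h1 := h (1 / n) (by positivity) y
    have h2 := (r (1 / n)).le_opNorm y
    have h3 : exp ((1 / n : ℝ) • (-a)) y = (y - (1 / n : ℝ) • a y) + r (1 / n) y := by
      simp only [hr, add_apply, sub_apply, one_apply_eq_self, smul_apply]
      abel
    have h4 := norm_sub_le_norm_add (y - (1 / n : ℝ) • a y) (r (1 / n) y)
    rw [h3]
    have h5 : m / n = 1 / n * m := by ring
    rw [h5]
    linarith
  have hpos : ∀ᶠ n : ℕ in atTop, 0 ≤ 1 + (-(m / n) - ‖r (1 / n)‖) := by
    have h1 : Tendsto (fun n : ℕ => 1 + (-(m / n) - ‖r (1 / n)‖)) atTop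
        (𝓝 (1 + (-0 - ‖r 0‖))) := by
      refine Tendsto.const_add _ (Tendsto.sub ?_ ?_)
      · exact (tendsto_const_div_atTop_nhds_zero_nat m).neg
      · exact (hrd.continuousAt.tendsto.comp tendsto_one_div_atTop_nhds_zero_nat).norm
    exact (h1.eventually (lt_mem_nhds (by simp [hr0]))).mono fun n hn => le_of_lt hn
  have hexp : Tendsto (fun n : ℕ => (1 + (-(m / n) - ‖r (1 / n)‖)) ^ n) atTop
      (𝓝 (Real.exp (-m))) := by
    refine Real.tendsto_one_add_pow_exp_of_tendsto ?_
    have h1 := hlim.const_sub (-m)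
    rw [sub_zero] at h1
    refine h1.congr' ?_
    filter_upwards [eventually_gt_atTop 0] with n hn
    field_simp
  refine ContinuousLinearMap.opNorm_le_bound _ (Real.exp_pos m).le fun x => ?_
  have hx : Real.exp (-m) * ‖exp a x‖ ≤ ‖x‖ := by
    refine le_of_tendsto (hexp.mul_const _) ?_
    filter_upwards [eventually_gt_atTop 0, hpos] with n hn hn0
    have hiter : ∀ k : ℕ, (1 + (-(m / n) - ‖r (1 / n)‖)) ^ k * ‖exp a x‖ ≤
        ‖(exp ((1 / n : ℝ) • (-a)) ^ k) (exp a x)‖ := by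
      intro k
      induction k with
      | zero => simp
      | succ k ih =>
        rw [pow_succ', pow_succ', mul_assoc]
        exact (mul_le_mul_of_nonneg_left ih hn0).trans (hstep n hn _)
    refine (hiter n).trans_eq ?_
    have hn' : (n : ℝ) ≠ 0 := by positivity
    rw [← exp_nsmul, ← Nat.cast_smul_eq_nsmul ℝ, smul_smul, mul_one_div_cancel hn', one_smul,
      ← mul_apply_eq_comp, ← exp_add_of_commute (Commute.neg_left (Commute.refl a)), neg_add_cancel,
      exp_zero, one_apply_eq_self]
  rw [Real.exp_neg, inv_mul_le_iff₀ (Real.exp_pos m)] at hx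
  exact hx

open NormedSpace in
/-- A form of Sinclair's theorem: the norm of a Hermitian operator on a Banach space is at most
its numerical radius. -/
theorem ContinuousLinearMap.norm_le_of_dissipative {Y : Type*} [NormedAddCommGroup Y]
    [NormedSpace ℂ Y] [CompleteSpace Y] (T : Y →L[ℂ] Y) {M : ℝ} (hM : 0 ≤ M)
    (h : ∀ (z : ℂ) (y : Y), (1 - M * |z.re|) * ‖y‖ ≤ ‖y - z • T y‖) : ‖T‖ ≤ M := by
  refine le_of_forall_gt_imp_ge_of_dense fun N hN => ?_
  have hN0 : 0 < N := hM.trans_lt hN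
  obtain ⟨φ, hφ, hφT⟩ := exists_dual_vector'' ℂ T
  set S : Y →L[ℂ] Y := (N⁻¹ : ℂ) • T with hS
  have hexp : ∀ w : ℂ, ‖exp (w • S)‖ ≤ Real.exp |w.re| := by
    refine fun w => norm_exp_le_of_dissipative _ _ fun t ht y => ?_
    have h1 := h (t * w * (N : ℂ)⁻¹) y
    have h2 : (t * w * (N : ℂ)⁻¹).re = t * w.re * N⁻¹ := by
      rw [← Complex.ofReal_inv, Complex.re_mul_ofReal, Complex.re_ofReal_mul]
    rw [h2, abs_mul, abs_mul, abs_of_pos ht, abs_of_pos (inv_pos.2 hN0)] at h1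
    have h3 : t • (w • S) y = (t * w * (N : ℂ)⁻¹) • T y := by
      simp only [hS, smul_apply, smul_smul]
      rw [← Complex.coe_smul, smul_smul, mul_assoc]
    rw [h3]
    refine le_trans ?_ h1
    refine mul_le_mul_of_nonneg_right (sub_le_sub_left ?_ 1) (norm_nonneg y)
    have h4 : M * N⁻¹ ≤ 1 := by
      rw [← div_eq_mul_inv, div_le_one hN0]
      exact hN.le
    calc M * (t * |w.re| * N⁻¹) = (M * N⁻¹) * (t * |w.re|) := by ring
      _ ≤ 1 * (t * |w.re|) := by gcongr
      _ = _ := one_mul _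
  have hd : ∀ w : ℂ, HasDerivAt (fun w : ℂ => φ (exp (w • S))) (φ (exp (w • S) * S)) w := fun w =>
    φ.hasFDerivAt.comp_hasDerivAt w (hasDerivAt_exp_smul_const S w)
  have key := norm_deriv_zero_le_one_of_norm_le_exp_abs_re (fun w => (hd w).differentiableAt)
    fun w => by
      calc ‖φ (exp (w • S))‖ ≤ ‖φ‖ * ‖exp (w • S)‖ := φ.le_opNorm _
        _ ≤ 1 * Real.exp |w.re| := by
          gcongr
          exact hexp w
        _ = _ := one_mul _
  rw [(hd 0).deriv, zero_smul, exp_zero, one_mul, hS, map_smul, hφT, smul_eq_mul, norm_mul,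
    norm_inv] at key
  simpa [inv_mul_le_one₀, abs_of_pos hN0, hN0] using key

open UniformSpace in
/-- `ContinuousLinearMap.norm_le_of_dissipative` without completeness. -/
theorem ContinuousLinearMap.norm_le_of_dissipative' {X : Type*} [NormedAddCommGroup X]
    [NormedSpace ℂ X] (T : X →L[ℂ] X) {M : ℝ} (hM : 0 ≤ M)
    (h : ∀ (z : ℂ) (x : X), (1 - M * |z.re|) * ‖x‖ ≤ ‖x - z • T x‖) : ‖T‖ ≤ M := by
  set e : X →L[ℂ] Completion X := Completion.toComplL
  have hde : DenseRange e := Completion.denseRange_coe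
  obtain ⟨T', hT'⟩ : ∃ T' : Completion X →L[ℂ] Completion X,
      ∀ x : X, T' x = (T x : Completion X) :=
    ⟨(e.comp T).extend e, extend_eq (e.comp T) hde (Completion.isUniformInducing_coe X)⟩
  have hnorm : ‖T'‖ ≤ M := by
    refine norm_le_of_dissipative T' hM fun z y => ?_
    have hl : Continuous fun y : Completion X => (1 - M * |z.re|) * ‖y‖ :=
      continuous_const.mul continuous_norm
    have hr : Continuous fun y : Completion X => ‖y - z • T' y‖ :=
      (continuous_id.sub (T'.continuous.const_smul z)).norm
    refine Completion.induction_on y (isClosed_le hl hr) fun x => ?_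
    rw [hT', ← Completion.coe_smul, ← Completion.coe_sub, Completion.norm_coe, Completion.norm_coe]
    exact h z x
  refine opNorm_le_bound _ hM fun x => ?_
  have := T'.le_of_opNorm_le hnorm x
  rwa [hT', Completion.norm_coe, Completion.norm_coe] at this

/-- A unit vector and a norming functional at it give a state of `X →L[ℂ] X`; hence a lower bound
for the norm of `x - T x`. -/
theorem ContinuousLinearMap.one_sub_mul_norm_le {X : Type*} [NormedAddCommGroup X]
    [NormedSpace ℂ X] (T : X →L[ℂ] X) {m : ℝ}
    (h : ∀ φ : (X →L[ℂ] X) →L[ℂ] ℂ, ‖φ‖ = 1 → φ 1 = 1 → (φ T).re ≤ m) (x : X) :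
    (1 - m) * ‖x‖ ≤ ‖x - T x‖ := by
  rcases eq_or_ne x 0 with rfl | hx
  · simp
  have hx0 : ‖x‖ ≠ 0 := norm_ne_zero_iff.2 hx
  have : Nontrivial X := ⟨x, 0, hx⟩
  obtain ⟨ψ, hψ, hψx⟩ := exists_dual_vector ℂ x hx0
  set φ : (X →L[ℂ] X) →L[ℂ] ℂ := (‖x‖⁻¹ : ℂ) • ψ.comp (apply ℂ X x) with hφ
  have hφa : ∀ S, φ S = (‖x‖⁻¹ : ℂ) * ψ (S x) := fun S => by simp [hφ]
  have hφ1 : φ 1 = 1 := by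
    rw [hφa, one_apply_eq_self, hψx]
    exact inv_mul_cancel₀ (by simpa using hx0)
  have hφn : ‖φ‖ = 1 := by
    refine le_antisymm (opNorm_le_bound _ zero_le_one fun S => ?_) ?_
    · have h1 := (ψ.le_opNorm (S x)).trans
        (mul_le_mul_of_nonneg_left (S.le_opNorm x) (norm_nonneg ψ))
      rw [hφa, norm_mul, norm_inv, Complex.norm_real, norm_norm,
        inv_mul_le_iff₀ (norm_pos_iff.2 hx)]
      rw [hψ] at h1
      linarith
    · have := φ.le_opNorm 1
      rwa [hφ1, norm_one, norm_one, mul_one] at this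
  have h1 := h φ hφn hφ1
  have h2 : (φ (1 - T)).re = 1 - (φ T).re := by simp [hφ1]
  have h3 : ‖φ (1 - T)‖ ≤ ‖x‖⁻¹ * ‖x - T x‖ := by
    rw [hφa, norm_mul, norm_inv, Complex.norm_real, norm_norm]
    have := ψ.le_opNorm ((1 - T) x)
    rw [hψ, one_mul] at this
    gcongr
    exact this
  have h4 : 1 - m ≤ ‖x‖⁻¹ * ‖x - T x‖ := by
    have := (Complex.re_le_norm (φ (1 - T))).trans h3
    linarith
  rwa [inv_mul_eq_div, le_div_iff₀ (norm_pos_iff.2 hx)] at h4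

/-- If `L` is a Hermitian bounded operator on a complex Banach space (its
numerical range is real) and `iD` is Hermitian, then `‖L + D‖ ≥ ‖D‖`. -/
theorem stmt16 (X : Type*) [NormedAddCommGroup X] [NormedSpace ℂ X]
    (L D : X →L[ℂ] X)
    (hL : ∀ φ : (X →L[ℂ] X) →L[ℂ] ℂ, ‖φ‖ = 1 → φ 1 = 1 → (φ L).im = 0)
    (hD : ∀ φ : (X →L[ℂ] X) →L[ℂ] ℂ, ‖φ‖ = 1 → φ 1 = 1 →
      (φ (Complex.I • D)).im = 0) :
    ‖D‖ ≤ ‖L + D‖ := by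
  have key : ‖Complex.I • D‖ ≤ ‖L + D‖ := by
    refine ContinuousLinearMap.norm_le_of_dissipative' _ (norm_nonneg _) fun z x => ?_
    refine ContinuousLinearMap.one_sub_mul_norm_le (z • Complex.I • D) (fun φ hφ hφ1 => ?_) x
    have hL' := hL φ hφ hφ1
    have hD' := hD φ hφ hφ1
    have h1 : |(φ D).im| ≤ ‖L + D‖ := by
      have h2 := φ.le_opNorm (L + D)
      rw [hφ, one_mul] at h2
      have h3 := (Complex.abs_im_le_norm (φ (L + D))).trans h2
      rwa [map_add, Complex.add_im, hL', zero_add] at h3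
    have h2 : (φ (z • Complex.I • D)).re = z.re * -(φ D).im := by
      rw [map_smul, smul_eq_mul, Complex.mul_re, hD', map_smul]
      simp
    rw [h2, mul_comm]
    refine (le_abs_self _).trans ?_
    rw [abs_mul, abs_neg]
    gcongr
  rwa [norm_smul, Complex.norm_I, one_mul] at key
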